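/- arXiv:1809.04555 — 10 statements merged into one kernel-verified Lean document; each statement's English description precedes it below -/
import Mathlib

section
/- For every integer n ≥ 1 and every integer m ≥ 2, the matrix R is invertible and its 2-norm condition number satisfies κ₂(R) ≤ (n + m + 3/2)/(m − 3/2). -/
open Real Finset

/-- `d_ℓ^m` from the Cholesky factor `R`. -/
noncomputable def dd (ℓ m : ℕ) : ℝ :=
  ((ℓ : ℝ) + m - 1) * Real.sqrt (((ℓ : ℝ) + m + 1) * ((ℓ : ℝ) + 2 * m) * ((ℓ : ℝ) + 2 * m + 1) /
    (((ℓ : ℝ) + m) * (2 * (ℓ : ℝ) + 2 * m - 1) * (2 * (ℓ : ℝ) + 2 * m + 1)))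

/-- `e_ℓ^m` from the Cholesky factor `R`. -/
noncomputable def ee (ℓ m : ℕ) : ℝ :=
  Real.sqrt ((ℓ : ℝ) * ((ℓ : ℝ) + 2 * m + 1) / (((ℓ : ℝ) + m) * ((ℓ : ℝ) + m + 1)))

/-- `f_ℓ^m` from the Cholesky factor `R`. -/
noncomputable def ff (ℓ m : ℕ) : ℝ :=
  ((ℓ : ℝ) + m + 2) * Real.sqrt ((ℓ : ℝ) * ((ℓ : ℝ) + 1) * ((ℓ : ℝ) + m) /
    (((ℓ : ℝ) + m + 1) * (2 * (ℓ : ℝ) + 2 * m + 1) * (2 * (ℓ : ℝ) + 2 * m + 3)))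

/-- The `n × n` upper-triangular banded matrix `R` with diagonal `d`, superdiagonal `-e`,
second superdiagonal `-f` (1-based indices shifted to 0-based `Fin n`). -/
noncomputable def Rmat (n m : ℕ) : Matrix (Fin n) (Fin n) ℝ :=
  Matrix.of fun i j : Fin n =>
    if (j : ℕ) = (i : ℕ) then dd ((i : ℕ) + 1) m
    else if (j : ℕ) = (i : ℕ) + 1 then -ee ((i : ℕ) + 1) m
    else if (j : ℕ) = (i : ℕ) + 2 then -ff ((i : ℕ) + 1) m
    else 0

/-- The operator norm on square real matrices induced by the Euclidean norm on `ℝⁿ`. -/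
noncomputable def opNorm2 {n : ℕ} (A : Matrix (Fin n) (Fin n) ℝ) : ℝ :=
  ‖Matrix.toEuclideanCLM (𝕜 := ℝ) A‖

lemma dd_le (ℓ m : ℕ) (hℓ : 1 ≤ ℓ) (hm : 1 ≤ m) :
    dd ℓ m ≤ ((ℓ : ℝ) + 2 * m + 1) / 2 := by
  have h1 : (1 : ℝ) ≤ ℓ := by exact_mod_cast hℓ
  have h2 : (1 : ℝ) ≤ m := by exact_mod_cast hm
  unfold dd
  obtain ⟨L, hL⟩ : ∃ L : ℝ, L = ℓ + m := ⟨_, rfl⟩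
  obtain ⟨a, ha⟩ : ∃ a : ℝ, a = ℓ + 2 * m := ⟨_, rfl⟩
  rw [show 2 * (ℓ : ℝ) + 2 * m = 2 * L by rw [hL]; ring, ← hL, ← ha]
  have hL2 : 2 ≤ L := by linarith
  have ha3 : 3 ≤ a := by linarith
  refine abs_le_of_sq_le_sq' ?_ (by linarith) |>.2
  have hden : 0 < L * (2 * L - 1) * (2 * L + 1) := by
    have : 0 < 2 * L - 1 := by linarith
    positivity
  rw [mul_pow, Real.sq_sqrt (by positivity), ← mul_div_assoc, div_le_iff₀ hden]
  have hcub : 4 * ((L - 1) ^ 2 * (L + 1)) ≤ L * (2 * L - 1) * (2 * L + 1) := by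
    nlinarith
  have ha' : a * (a + 1) ≤ (a + 1) ^ 2 := by nlinarith
  have := mul_le_mul hcub ha' (by positivity) hden.le
  linarith

lemma le_dd (ℓ m : ℕ) (hℓ : 1 ≤ ℓ) (hm : 1 ≤ m) :
    ((ℓ : ℝ) + 2 * m - 1) / 2 ≤ dd ℓ m := by
  have h1 : (1 : ℝ) ≤ ℓ := by exact_mod_cast hℓ
  have h2 : (1 : ℝ) ≤ m := by exact_mod_cast hm
  unfold dd
  obtain ⟨L, hL⟩ : ∃ L : ℝ, L = ℓ + m := ⟨_, rfl⟩
  obtain ⟨a, ha⟩ : ∃ a : ℝ, a = ℓ + 2 * m := ⟨_, rfl⟩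
  rw [show 2 * (ℓ : ℝ) + 2 * m = 2 * L by rw [hL]; ring, ← hL, ← ha]
  have hL2 : 2 ≤ L := by linarith
  have ha1 : 0 ≤ a - L - 1 := by linarith
  have ha2 : 0 ≤ 2 * L - 1 - a := by linarith
  have hpos : 0 ≤ L - 1 := by linarith
  have ha0 : 0 < a := by linarith
  refine abs_le_of_sq_le_sq' ?_ (mul_nonneg hpos (Real.sqrt_nonneg _)) |>.2
  have hden : 0 < L * (2 * L - 1) * (2 * L + 1) := by
    have : 0 < 2 * L - 1 := by linarith
    positivity
  rw [mul_pow, Real.sq_sqrt (by positivity), ← mul_div_assoc, le_div_iff₀ hden]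
  obtain ⟨t, rfl⟩ : ∃ t, L = t + 2 := ⟨L - 2, by ring⟩
  obtain ⟨u, rfl⟩ : ∃ u, a = t + 2 + 1 + u := ⟨a - (t + 2) - 1, by ring⟩
  have ht : 0 ≤ t := by linarith
  have hu : 0 ≤ u := by linarith
  obtain ⟨v, rfl⟩ : ∃ v, t = u + v := ⟨t - u, by ring⟩
  have hv : 0 ≤ v := by linarith
  rw [← sub_nonneg]
  ring_nf
  positivity

lemma ee_nonneg (ℓ m : ℕ) : 0 ≤ ee ℓ m := Real.sqrt_nonneg _

lemma ee_le_one (ℓ m : ℕ) : ee ℓ m ≤ 1 := by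
  unfold ee
  rw [Real.sqrt_le_one]
  refine div_le_one_of_le₀ ?_ (by positivity)
  have : (0 : ℝ) ≤ m := Nat.cast_nonneg m
  nlinarith

lemma ff_nonneg (ℓ m : ℕ) : 0 ≤ ff ℓ m := by
  unfold ff
  positivity

lemma ff_le (ℓ m : ℕ) : ff ℓ m ≤ ((ℓ : ℝ) + 1) / 2 := by
  have h1 : (0 : ℝ) ≤ ℓ := Nat.cast_nonneg ℓ
  have h2 : (0 : ℝ) ≤ m := Nat.cast_nonneg m
  unfold ff
  refine abs_le_of_sq_le_sq' ?_ (by positivity) |>.2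
  rw [mul_pow, Real.sq_sqrt (by positivity), ← mul_div_assoc, div_le_iff₀ (by positivity),
    ← sub_nonneg]
  ring_nf
  positivity

/-- Entries of `Rmat` are dominated by a matrix with three constant bands. -/
lemma abs_Rmat_le (n m : ℕ) (hm : 1 ≤ m) (i j : Fin n) :
    |Rmat n m i j| ≤ (if (j : ℕ) = i then ((n : ℝ) + 2 * m + 1) / 2 else 0) +
      (if (j : ℕ) = i + 1 then 1 else 0) + (if (j : ℕ) = i + 2 then ((n : ℝ) - 1) / 2 else 0) := by
  have hj := j.isLt
  simp only [Rmat, Matrix.of_apply]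
  split_ifs with h h' h' h'' h'' <;> try omega
  · have hi : ((i : ℕ) : ℝ) + 1 ≤ n := by exact_mod_cast i.isLt
    have hd := dd_le (i + 1) m (by omega) hm
    have hd' := le_dd (i + 1) m (by omega) hm
    push_cast at hd hd'
    have h1 : (1 : ℝ) ≤ m := by exact_mod_cast hm
    rw [abs_of_nonneg (le_trans (by linarith [(i : ℕ).cast_nonneg (α := ℝ)]) hd')]
    linarith
  · rw [abs_neg, abs_of_nonneg (ee_nonneg _ _)]
    linarith [ee_le_one (i + 1) m]
  · have hi : ((i : ℕ) : ℝ) + 3 ≤ n := by exact_mod_cast (by omega : (i : ℕ) + 3 ≤ n)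
    have hf := ff_le (i + 1) m
    push_cast at hf
    rw [abs_neg, abs_of_nonneg (ff_nonneg _ _)]
    linarith
  · simp

/-- Lower bound for the terms of the quadratic form of `Rmat`. -/
lemma le_mul_Rmat_mul (n m : ℕ) (hm : 1 ≤ m) (x : Fin n → ℝ) (i j : Fin n) :
    (if (j : ℕ) = i then ((i : ℝ) + 2 * m) / 2 * x i ^ 2 else 0)
      - (if (j : ℕ) = i + 1 then 1 / 2 * x i ^ 2 else 0)
      - (if (j : ℕ) = i + 1 then 1 / 2 * x j ^ 2 else 0)
      - (if (j : ℕ) = i + 2 then ((i : ℝ) + 2) / 4 * x i ^ 2 else 0)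
      - (if (j : ℕ) = i + 2 then (j : ℝ) / 4 * x j ^ 2 else 0) ≤ x i * Rmat n m i j * x j := by
  simp only [Rmat, Matrix.of_apply]
  split_ifs with h h' h' h'' h'' <;> try omega
  · obtain rfl : j = i := Fin.ext h
    have hd := le_dd (j + 1) m (by omega) hm
    push_cast at hd
    nlinarith [mul_le_mul_of_nonneg_right hd (sq_nonneg (x j))]
  · have h0 := ee_nonneg (i + 1) m
    have h1 := ee_le_one (i + 1) m
    nlinarith [mul_nonneg h0 (sq_nonneg (x i - x j)),
      mul_nonneg (sub_nonneg.2 h1) (add_nonneg (sq_nonneg (x i)) (sq_nonneg (x j)))]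
  · have h0 := ff_nonneg (i + 1) m
    have h1 := ff_le (i + 1) m
    have hj : ((j : ℕ) : ℝ) = i + 2 := by exact_mod_cast (by omega : (j : ℕ) = i + 2)
    push_cast at h1
    rw [hj]
    nlinarith [mul_nonneg h0 (sq_nonneg (x i - x j)),
      mul_nonneg (sub_nonneg.2 h1) (add_nonneg (sq_nonneg (x i)) (sq_nonneg (x j)))]
  · simp

lemma sum_ite_val_eq_le {n : ℕ} (p : Fin n → Prop) [DecidablePred p]
    (hp : ∀ i j, p i → p j → i = j) {c : ℝ} (hc : 0 ≤ c) :
    ∑ i, (if p i then c else 0) ≤ c := by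
  by_cases h : ∃ i, p i
  · obtain ⟨i, hi⟩ := h
    rw [Finset.sum_eq_single i (fun j _ hj => if_neg fun h => hj (hp j i h hi))
      (fun h => absurd (Finset.mem_univ i) h), if_pos hi]
  · push Not at h
    simpa [h] using hc

lemma sum_abs_row_Rmat_le (n m : ℕ) (hm : 1 ≤ m) (i : Fin n) :
    ∑ j, |Rmat n m i j| ≤ (n : ℝ) + m + 3 / 2 := by
  have hn : (1 : ℝ) ≤ n := by exact_mod_cast (by have := i.isLt; omega : 1 ≤ n)
  refine (Finset.sum_le_sum fun j _ => abs_Rmat_le n m hm i j).trans ?_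
  rw [Finset.sum_add_distrib, Finset.sum_add_distrib]
  have h0 := sum_ite_val_eq_le (fun j : Fin n => (j : ℕ) = i) (fun _ _ _ _ => Fin.ext (by omega))
    (c := ((n : ℝ) + 2 * m + 1) / 2) (by positivity)
  have h1 := sum_ite_val_eq_le (fun j : Fin n => (j : ℕ) = i + 1)
    (fun _ _ _ _ => Fin.ext (by omega)) zero_le_one
  have h2 := sum_ite_val_eq_le (fun j : Fin n => (j : ℕ) = i + 2)
    (fun _ _ _ _ => Fin.ext (by omega)) (c := ((n : ℝ) - 1) / 2) (by linarith)
  linarith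

lemma sum_abs_col_Rmat_le (n m : ℕ) (hm : 1 ≤ m) (j : Fin n) :
    ∑ i, |Rmat n m i j| ≤ (n : ℝ) + m + 3 / 2 := by
  have hn : (1 : ℝ) ≤ n := by exact_mod_cast (by have := j.isLt; omega : 1 ≤ n)
  refine (Finset.sum_le_sum fun i _ => abs_Rmat_le n m hm i j).trans ?_
  rw [Finset.sum_add_distrib, Finset.sum_add_distrib]
  have h0 := sum_ite_val_eq_le (fun i : Fin n => (j : ℕ) = i) (fun _ _ _ _ => Fin.ext (by omega))
    (c := ((n : ℝ) + 2 * m + 1) / 2) (by positivity)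
  have h1 := sum_ite_val_eq_le (fun i : Fin n => (j : ℕ) = i + 1)
    (fun _ _ _ _ => Fin.ext (by omega)) zero_le_one
  have h2 := sum_ite_val_eq_le (fun i : Fin n => (j : ℕ) = i + 2)
    (fun _ _ _ _ => Fin.ext (by omega)) (c := ((n : ℝ) - 1) / 2) (by linarith)
  linarith

/-- Schur test: bounded absolute row and column sums bound the operator norm. -/
lemma opNorm2_le_of_sum_abs_le {n : ℕ} (A : Matrix (Fin n) (Fin n) ℝ) {C : ℝ} (hC : 0 ≤ C)
    (hrow : ∀ i, ∑ j, |A i j| ≤ C) (hcol : ∀ j, ∑ i, |A i j| ≤ C) : opNorm2 A ≤ C := by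
  refine ContinuousLinearMap.opNorm_le_bound _ hC fun x => ?_
  refine abs_le_of_sq_le_sq' ?_ (by positivity) |>.2
  rw [mul_pow, EuclideanSpace.real_norm_sq_eq, EuclideanSpace.real_norm_sq_eq]
  have hi (i : Fin n) : (∑ j, A i j * x j) ^ 2 ≤ C * ∑ j, |A i j| * x j ^ 2 := by
    refine (Finset.sum_sq_le_sum_mul_sum_of_sq_le_mul Finset.univ (f := fun j => |A i j|)
      (g := fun j => |A i j| * x j ^ 2) (fun _ _ => abs_nonneg _) (fun _ _ => by positivity)
      fun j _ => le_of_eq ?_).trans ?_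
    · rw [mul_pow, ← sq_abs (A i j)]
      ring
    · exact mul_le_mul_of_nonneg_right (hrow i) (Finset.sum_nonneg fun _ _ => by positivity)
  calc ∑ i, (Matrix.toEuclideanCLM (𝕜 := ℝ) A x) i ^ 2
      = ∑ i, (∑ j, A i j * x j) ^ 2 := rfl
    _ ≤ ∑ i, C * ∑ j, |A i j| * x j ^ 2 := Finset.sum_le_sum fun i _ => hi i
    _ = C * ∑ j, (∑ i, |A i j|) * x j ^ 2 := by
      rw [← Finset.mul_sum, Finset.sum_comm]
      simp_rw [Finset.sum_mul]
    _ ≤ C * ∑ j, C * x j ^ 2 := by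
      gcongr with j
      exact hcol j
    _ = C ^ 2 * ∑ j, x j ^ 2 := by rw [← Finset.mul_sum]; ring

lemma le_quadForm_Rmat (n m : ℕ) (hm : 1 ≤ m) (x : Fin n → ℝ) :
    ((m : ℝ) - 3 / 2) * ∑ i, x i ^ 2 ≤ ∑ i, ∑ j, x i * Rmat n m i j * x j := by
  refine le_trans ?_ (Finset.sum_le_sum fun i _ => Finset.sum_le_sum fun j _ =>
    le_mul_Rmat_mul n m hm x i j)
  simp only [Finset.sum_sub_distrib]
  have h0 (i : Fin n) : ∑ j : Fin n, (if (j : ℕ) = i then ((i : ℝ) + 2 * m) / 2 * x i ^ 2 else 0)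
      = ((i : ℝ) + 2 * m) / 2 * x i ^ 2 := by
    simp [Fin.val_inj]
  have hrow (k : ℕ) (c : Fin n → ℝ) (hc : ∀ i, 0 ≤ c i) :
      ∑ i : Fin n, ∑ j : Fin n, (if (j : ℕ) = i + k then c i else 0) ≤ ∑ i, c i :=
    Finset.sum_le_sum fun i _ => sum_ite_val_eq_le (fun j : Fin n => (j : ℕ) = i + k)
      (fun _ _ _ _ => Fin.ext (by omega)) (hc i)
  have hcol (k : ℕ) (c : Fin n → ℝ) (hc : ∀ i, 0 ≤ c i) :
      ∑ i : Fin n, ∑ j : Fin n, (if (j : ℕ) = i + k then c j else 0) ≤ ∑ j, c j := by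
    rw [Finset.sum_comm]
    exact Finset.sum_le_sum fun j _ => sum_ite_val_eq_le (fun i : Fin n => (j : ℕ) = i + k)
      (fun _ _ _ _ => Fin.ext (by omega)) (hc j)
  have h1 := hrow 1 (fun i => 1 / 2 * x i ^ 2) fun i => by positivity
  have h2 := hcol 1 (fun i => 1 / 2 * x i ^ 2) fun i => by positivity
  have h3 := hrow 2 (fun i => ((i : ℝ) + 2) / 4 * x i ^ 2) fun i => by positivity
  have h4 := hcol 2 (fun i => (i : ℝ) / 4 * x i ^ 2) fun i => by positivity
  have hsum : ((m : ℝ) - 3 / 2) * ∑ i, x i ^ 2 = ∑ i : Fin n, ((i : ℝ) + 2 * m) / 2 * x i ^ 2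
      - ∑ i, 1 / 2 * x i ^ 2 - ∑ i, 1 / 2 * x i ^ 2
      - ∑ i : Fin n, ((i : ℝ) + 2) / 4 * x i ^ 2 - ∑ i : Fin n, (i : ℝ) / 4 * x i ^ 2 := by
    simp only [← Finset.sum_sub_distrib, Finset.mul_sum]
    exact Finset.sum_congr rfl fun i _ => by ring
  simp only [h0]
  linarith

/-- A coercive matrix is bounded below. -/
lemma mul_norm_le_norm_toEuclideanCLM {n : ℕ} {A : Matrix (Fin n) (Fin n) ℝ} {c : ℝ}
    (hA : ∀ x : Fin n → ℝ, c * ∑ i, x i ^ 2 ≤ ∑ i, ∑ j, x i * A i j * x j)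
    (x : EuclideanSpace ℝ (Fin n)) : c * ‖x‖ ≤ ‖Matrix.toEuclideanCLM (𝕜 := ℝ) A x‖ := by
  rcases (norm_nonneg x).eq_or_lt' with hx | hx
  · simp [hx]
  refine le_of_mul_le_mul_right ?_ hx
  have hinner : ∑ i, ∑ j, x i * A i j * x j = inner ℝ (Matrix.toEuclideanCLM (𝕜 := ℝ) A x) x := by
    rw [PiLp.inner_apply]
    refine Finset.sum_congr rfl fun i _ => ?_
    change _ = x i * ∑ j, A i j * x j
    rw [Finset.mul_sum]
    exact Finset.sum_congr rfl fun j _ => by ring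
  calc c * ‖x‖ * ‖x‖ = c * ∑ i, x i ^ 2 := by rw [← EuclideanSpace.real_norm_sq_eq]; ring
    _ ≤ _ := hA x
    _ = _ := hinner
    _ ≤ _ := real_inner_le_norm _ _

lemma isUnit_of_coercive {n : ℕ} {A : Matrix (Fin n) (Fin n) ℝ} {c : ℝ} (hc : 0 < c)
    (hA : ∀ x : Fin n → ℝ, c * ∑ i, x i ^ 2 ≤ ∑ i, ∑ j, x i * A i j * x j) : IsUnit A := by
  rw [← Matrix.mulVec_injective_iff_isUnit]
  refine (injective_iff_map_eq_zero A.mulVecLin).2 fun x hx => ?_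
  have hx' : Matrix.toEuclideanCLM (𝕜 := ℝ) A (WithLp.toLp 2 x) = 0 :=
    congrArg (WithLp.toLp 2) hx
  have h := mul_norm_le_norm_toEuclideanCLM hA (WithLp.toLp 2 x)
  rw [hx', norm_zero] at h
  have h0 : ‖WithLp.toLp 2 x‖ = 0 :=
    le_antisymm (nonpos_of_mul_nonpos_right h hc) (norm_nonneg _)
  exact congrArg WithLp.ofLp (norm_eq_zero.1 h0)

lemma opNorm2_inv_le_of_coercive {n : ℕ} {A : Matrix (Fin n) (Fin n) ℝ} {c : ℝ} (hc : 0 < c)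
    (hA : ∀ x : Fin n → ℝ, c * ∑ i, x i ^ 2 ≤ ∑ i, ∑ j, x i * A i j * x j) :
    opNorm2 A⁻¹ ≤ c⁻¹ := by
  refine ContinuousLinearMap.opNorm_le_bound _ (by positivity) fun y => ?_
  have h := mul_norm_le_norm_toEuclideanCLM hA (Matrix.toEuclideanCLM (𝕜 := ℝ) A⁻¹ y)
  rw [← mul_apply_eq_comp, ← map_mul,
    Matrix.mul_nonsing_inv A ((Matrix.isUnit_iff_isUnit_det A).1 (isUnit_of_coercive hc hA)),
    map_one, one_apply_eq_self] at h
  rwa [inv_mul_eq_div, le_div_iff₀' hc]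

theorem stmt0 (n m : ℕ) (hn : 1 ≤ n) (hm : 2 ≤ m) :
    IsUnit (Rmat n m) ∧
      opNorm2 (Rmat n m) * opNorm2 (Rmat n m)⁻¹ ≤ ((n : ℝ) + m + 3 / 2) / ((m : ℝ) - 3 / 2) := by
  have hm' : (2 : ℝ) ≤ m := by exact_mod_cast hm
  have hc : (0 : ℝ) < m - 3 / 2 := by linarith
  have hA := le_quadForm_Rmat n m (by omega)
  refine ⟨isUnit_of_coercive hc hA, ?_⟩
  rw [div_eq_mul_inv]
  exact mul_le_mul
    (opNorm2_le_of_sum_abs_le _ (by positivity) (sum_abs_row_Rmat_le n m (by omega))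
      (sum_abs_col_Rmat_le n m (by omega)))
    (opNorm2_inv_le_of_coercive hc hA) (norm_nonneg _) (by positivity)
end

section
/- For all positive integers ℓ and m, the following three inequalities hold: d_ℓ^m ≤ (ℓ + 2m)/2, e_ℓ^m ≤ 1, and f_ℓ^m ≤ (ℓ + 1)/2. -/
open Real Finset

theorem mul_sqrt_div_le {c x y b : ℝ} (hb : 0 ≤ b) (hy : 0 < y) (h : c ^ 2 * x ≤ b ^ 2 * y) :
    c * √(x / y) ≤ b := by
  rcases le_or_gt 0 (x / y) with hx | hx
  · refine (abs_le_of_sq_le_sq' ?_ hb).2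
    rwa [mul_pow, sq_sqrt hx, ← mul_div_assoc, div_le_iff₀ hy]
  · rwa [sqrt_eq_zero_of_nonpos hx.le, mul_zero]

theorem stmt2 (ℓ m : ℕ) (hℓ : 1 ≤ ℓ) (hm : 1 ≤ m) :
    dd ℓ m ≤ ((ℓ : ℝ) + 2 * m) / 2 ∧ ee ℓ m ≤ 1 ∧ ff ℓ m ≤ ((ℓ : ℝ) + 1) / 2 := by
  obtain ⟨k, rfl⟩ := Nat.exists_eq_add_of_le' hℓ
  obtain ⟨j, rfl⟩ := Nat.exists_eq_add_of_le' hm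
  have hk : (0 : ℝ) ≤ k := k.cast_nonneg
  have hj : (0 : ℝ) ≤ j := j.cast_nonneg
  unfold dd ee ff
  push_cast
  generalize (k : ℝ) = x at hk ⊢
  generalize (j : ℝ) = y at hj ⊢
  have hs : 0 < 2 * (x + 1) + 2 * (y + 1) - 1 := by linarith
  refine ⟨mul_sqrt_div_le (by positivity) (by positivity) ?_, ?_,
    mul_sqrt_div_le (by positivity) (by positivity) ?_⟩
  · rw [← sub_nonneg]
    ring_nf
    positivity
  · rw [Real.sqrt_le_one, div_le_one₀ (by positivity), ← sub_nonneg]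
    ring_nf
    positivity
  · rw [← sub_nonneg]
    ring_nf
    positivity
end

section
/- For all positive integers ℓ and m, f_ℓ^m ≤ ((ℓ+1)/2)·[1 − (4ℓ²m + 8ℓm² + 4m³ + 7ℓ² + 19ℓm + 12m² + 14ℓ + 11m + 3)/(2(ℓ+1)(ℓ+m+1)(2ℓ+2m+1)(2ℓ+2m+3))]. -/
open Real Finset

theorem stmt4 (ℓ m : ℕ) (hℓ : 1 ≤ ℓ) (hm : 1 ≤ m) :
    ff ℓ m ≤ (((ℓ : ℝ) + 1) / 2) *
      (1 - (4 * (ℓ : ℝ) ^ 2 * m + 8 * ℓ * (m : ℝ) ^ 2 + 4 * (m : ℝ) ^ 3 + 7 * (ℓ : ℝ) ^ 2 +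
            19 * (ℓ : ℝ) * m + 12 * (m : ℝ) ^ 2 + 14 * ℓ + 11 * m + 3) /
          (2 * ((ℓ : ℝ) + 1) * ((ℓ : ℝ) + m + 1) * (2 * (ℓ : ℝ) + 2 * m + 1) *
            (2 * (ℓ : ℝ) + 2 * m + 3))) := by
  unfold ff
  have hL : (0 : ℝ) < ℓ := by exact_mod_cast hℓ
  have hM : (0 : ℝ) < m := by exact_mod_cast hm
  generalize (ℓ : ℝ) = l at *
  generalize (m : ℝ) = k at *
  set D : ℝ := (l + k + 1) * (2 * l + 2 * k + 1) * (2 * l + 2 * k + 3) with hD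
  set N : ℝ := 4 * l ^ 2 * k + 8 * l * k ^ 2 + 4 * k ^ 3 + 7 * l ^ 2 + 19 * l * k + 12 * k ^ 2 +
    14 * l + 11 * k + 3 with hN
  have hDpos : 0 < D := by positivity
  -- Both sides are compared after squaring; the difference has nonnegative coefficients.
  have hP : 0 ≤ 2 * (l + 1) * D - N := by
    have h : 2 * (l + 1) * D - N = 3 + 11 * k + 12 * k ^ 2 + 4 * k ^ 3 + 14 * l + 51 * l * k +
        40 * l * k ^ 2 + 8 * l * k ^ 3 + 39 * l ^ 2 + 68 * l ^ 2 * k + 24 * l ^ 2 * k ^ 2 +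
        32 * l ^ 3 + 24 * l ^ 3 * k + 8 * l ^ 4 := by
      rw [hD, hN]; ring
    rw [h]; positivity
  have hsq : 16 * D * (l + k + 2) ^ 2 * (l * (l + 1) * (l + k)) ≤ (2 * (l + 1) * D - N) ^ 2 := by
    rw [← sub_nonneg]
    have h : (2 * (l + 1) * D - N) ^ 2 - 16 * D * (l + k + 2) ^ 2 * (l * (l + 1) * (l + k)) =
        9 + 66 * k + 193 * k ^ 2 + 288 * k ^ 3 + 232 * k ^ 4 +
          96 * k ^ 5 + 16 * k ^ 6 + 84 * l + 422 * l * k + 802 * l * k ^ 2 +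
          744 * l * k ^ 3 + 344 * l * k ^ 4 + 64 * l * k ^ 5 + 238 * l ^ 2 + 710 * l ^ 2 * k +
          841 * l ^ 2 * k ^ 2 + 456 * l ^ 2 * k ^ 3 + 96 * l ^ 2 * k ^ 4 + 196 * l ^ 3 + 378 * l ^ 3 * k +
          264 * l ^ 3 * k ^ 2 + 64 * l ^ 3 * k ^ 3 + 49 * l ^ 4 + 56 * l ^ 4 * k + 16 * l ^ 4 * k ^ 2 := by
      rw [hD, hN]; ring
    rw [h]; positivity
  have hrhs : (l + 1) / 2 * (1 - N / (2 * (l + 1) * (l + k + 1) * (2 * l + 2 * k + 1) *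
      (2 * l + 2 * k + 3))) = (2 * (l + 1) * D - N) / (4 * D) := by
    have h : 2 * (l + 1) * (l + k + 1) * (2 * l + 2 * k + 1) * (2 * l + 2 * k + 3) =
        2 * (l + 1) * D := by rw [hD]; ring
    rw [h]
    field_simp
    ring
  rw [hrhs]
  refine (pow_le_pow_iff_left₀ (by positivity) (div_nonneg hP (by positivity)) two_ne_zero).1 ?_
  rw [mul_pow, Real.sq_sqrt (by positivity), div_pow, ← mul_div_assoc,
    div_le_div_iff₀ hDpos (by positivity)]
  calc (l + k + 2) ^ 2 * (l * (l + 1) * (l + k)) * (4 * D) ^ 2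
      = 16 * D * (l + k + 2) ^ 2 * (l * (l + 1) * (l + k)) * D := by ring
    _ ≤ (2 * (l + 1) * D - N) ^ 2 * D := by gcongr
end

section
/- For all positive integers ℓ and m, d_ℓ^m ≥ ((ℓ+2m)/2)·[1 − (4ℓ²m + 8ℓm² + 4m³ + 7ℓ² + 17ℓm + 10m² − 4m − 4)/(8(ℓ+m−1)²(ℓ+m+1)(ℓ+2m+1))]. -/
open Real Finset

/-- First-order lower bound for the inverse square root: if `x² (1 + 2δ) = y²`, then
`y (1 - δ) ≤ x`. -/
lemma mul_one_sub_le_of_sq_mul_eq {x y δ : ℝ} (hx : 0 ≤ x) (hy : 0 ≤ y)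
    (h : x ^ 2 * (1 + 2 * δ) = y ^ 2) : y * (1 - δ) ≤ x := by
  rcases le_total 1 δ with h1 | h1
  · exact (mul_nonpos_of_nonneg_of_nonpos hy (by linarith)).trans hx
  · refine (pow_le_pow_iff_left₀ (mul_nonneg hy (by linarith)) hx two_ne_zero).1 ?_
    have hfac : (1 + 2 * δ) * (1 - δ) ^ 2 ≤ 1 := by
      nlinarith [mul_nonneg (sq_nonneg δ) (by linarith : 0 ≤ 3 - 2 * δ)]
    calc (y * (1 - δ)) ^ 2 = x ^ 2 * ((1 + 2 * δ) * (1 - δ) ^ 2) := by rw [mul_pow, ← h]; ring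
      _ ≤ x ^ 2 * 1 := mul_le_mul_of_nonneg_left hfac (sq_nonneg x)
      _ = x ^ 2 := mul_one _

theorem stmt5 (ℓ m : ℕ) (hℓ : 1 ≤ ℓ) (hm : 1 ≤ m) :
    dd ℓ m ≥ (((ℓ : ℝ) + 2 * m) / 2) *
      (1 - (4 * (ℓ : ℝ) ^ 2 * m + 8 * ℓ * (m : ℝ) ^ 2 + 4 * (m : ℝ) ^ 3 + 7 * (ℓ : ℝ) ^ 2 +
            17 * (ℓ : ℝ) * m + 10 * (m : ℝ) ^ 2 - 4 * m - 4) /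
          (8 * ((ℓ : ℝ) + m - 1) ^ 2 * ((ℓ : ℝ) + m + 1) * ((ℓ : ℝ) + 2 * m + 1))) := by
  have hl : (1 : ℝ) ≤ ℓ := by exact_mod_cast hℓ
  have hm' : (1 : ℝ) ≤ m := by exact_mod_cast hm
  unfold dd
  generalize (ℓ : ℝ) = a at *
  generalize (m : ℝ) = b at *
  have h1 : 0 < a + b - 1 := by linarith
  have h2 : 0 < 2 * a + 2 * b - 1 := by linarith
  have ha : 0 < a := by linarith
  have hb : 0 < b := by linarith
  refine mul_one_sub_le_of_sq_mul_eq (by positivity) (by positivity) ?_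
  rw [mul_pow, Real.sq_sqrt (by positivity)]
  have h3 : (a + b) * 2 - 1 ≠ 0 := (by linarith : 0 < (a + b) * 2 - 1).ne'
  field_simp
  ring
end

section
/- For m = 1, the sequence (d_ℓ^1)_{ℓ≥1} is strictly increasing: d_{ℓ+1}^1 > d_ℓ^1 for every positive integer ℓ. -/
open Real Finset

theorem dd_one_eq (ℓ : ℕ) : dd ℓ 1 = √((ℓ : ℝ) ^ 2 * (ℓ + 2) ^ 2 * (ℓ + 3) /
    ((ℓ + 1) * (2 * ℓ + 1) * (2 * ℓ + 3))) := by
  have h : (ℓ : ℝ) ^ 2 * (ℓ + 2) ^ 2 * (ℓ + 3) / ((ℓ + 1) * (2 * ℓ + 1) * (2 * ℓ + 3)) =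
      (ℓ : ℝ) ^ 2 * ((ℓ + 2) * (ℓ + 2) * (ℓ + 3) / ((ℓ + 1) * (2 * ℓ + 1) * (2 * ℓ + 3))) := by
    ring
  rw [h, Real.sqrt_mul (by positivity), Real.sqrt_sq (by positivity), dd]
  push_cast
  ring_nf

theorem stmt10 (ℓ : ℕ) (hℓ : 1 ≤ ℓ) : dd (ℓ + 1) 1 > dd ℓ 1 := by
  rw [gt_iff_lt, dd_one_eq, dd_one_eq]
  apply Real.sqrt_lt_sqrt (by positivity)
  obtain ⟨k, rfl⟩ := Nat.exists_eq_add_of_le hℓ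
  push_cast
  rw [div_lt_div_iff₀ (by positivity) (by positivity), ← sub_pos]
  ring_nf
  positivity
end

section
/- For m = 1 and every positive integer ℓ, the ratio e_ℓ^1/d_ℓ^1 satisfies e_ℓ^1/d_ℓ^1 ≤ 2/(ℓ+1). -/
open Real Finset

theorem stmt11 (ℓ : ℕ) (hℓ : 1 ≤ ℓ) : ee ℓ 1 / dd ℓ 1 ≤ 2 / ((ℓ : ℝ) + 1) := by
  have hx : (1 : ℝ) ≤ ℓ := by exact_mod_cast hℓ
  unfold ee dd
  push_cast
  generalize (ℓ : ℝ) = x at hx ⊢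
  have hden : 0 < 2 * x + 2 * 1 - 1 := by linarith
  have hd : 0 < (x + 1 - 1) * √((x + 1 + 1) * (x + 2 * 1) * (x + 2 * 1 + 1) /
      ((x + 1) * (2 * x + 2 * 1 - 1) * (2 * x + 2 * 1 + 1))) := by
    have : 0 < x + 1 - 1 := by linarith
    positivity
  rw [div_le_iff₀ hd, ← mul_assoc]
  apply Real.sqrt_le_iff.mpr
  refine ⟨by rw [mul_assoc]; positivity, ?_⟩
  rw [mul_pow, Real.sq_sqrt (by positivity), ← sub_nonneg]
  have key : 0 ≤ 4 * x * (x + 2) ^ 3 - (2 * x + 1) * (2 * x + 3) * (x + 1) ^ 2 := by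
    obtain ⟨t, rfl⟩ : ∃ t, x = t + 1 := ⟨x - 1, by ring⟩
    have ht : 0 ≤ t := by linarith
    ring_nf
    positivity
  have hfactor : (2 / (x + 1) * (x + 1 - 1)) ^ 2 * ((x + 1 + 1) * (x + 2 * 1) * (x + 2 * 1 + 1) /
      ((x + 1) * (2 * x + 2 * 1 - 1) * (2 * x + 2 * 1 + 1))) -
      x * (x + 2 * 1 + 1) / ((x + 1) * (x + 1 + 1)) =
      x * (x + 3) * (4 * x * (x + 2) ^ 3 - (2 * x + 1) * (2 * x + 3) * (x + 1) ^ 2) /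
        ((x + 1) ^ 3 * (x + 2) * (2 * x + 1) * (2 * x + 3)) := by
    rw [show 2 * x + 2 * 1 - 1 = 2 * x + 1 by ring, show 2 * x + 2 * 1 + 1 = 2 * x + 3 by ring,
      show x + 1 + 1 = x + 2 by ring]
    field_simp
    ring
  rw [hfactor]
  positivity
end

section
/- For m = 1 and every positive integer ℓ, the ratio f_ℓ^1/d_ℓ^1 satisfies f_ℓ^1/d_ℓ^1 ≤ 1 − 1/ℓ + 5/(2ℓ(ℓ+2)). -/
open Real Finset

theorem dd_one_sq (ℓ : ℕ) : dd ℓ 1 ^ 2 =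
    (ℓ : ℝ) ^ 2 * (((ℓ : ℝ) + 2) ^ 2 * ((ℓ : ℝ) + 3) /
      (((ℓ : ℝ) + 1) * (2 * (ℓ : ℝ) + 1) * (2 * (ℓ : ℝ) + 3))) := by
  have h : (2 * (ℓ : ℝ) + 2 * (1 : ℕ) - 1) = 2 * (ℓ : ℝ) + 1 := by push_cast; ring
  rw [dd, h, mul_pow, Real.sq_sqrt (by positivity)]
  push_cast
  ring_nf

theorem ff_one_sq (ℓ : ℕ) : ff ℓ 1 ^ 2 =
    ((ℓ : ℝ) + 3) ^ 2 * ((ℓ : ℝ) * ((ℓ : ℝ) + 1) ^ 2 /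
      (((ℓ : ℝ) + 2) * (2 * (ℓ : ℝ) + 3) * (2 * (ℓ : ℝ) + 5))) := by
  rw [ff, mul_pow, Real.sq_sqrt (by positivity)]
  push_cast
  ring_nf

theorem sq_ff_one_div_dd_one {ℓ : ℕ} (hℓ : 1 ≤ ℓ) : (ff ℓ 1 / dd ℓ 1) ^ 2 =
    ((ℓ : ℝ) + 1) ^ 3 * ((ℓ : ℝ) + 3) * (2 * (ℓ : ℝ) + 1) /
      ((ℓ : ℝ) * ((ℓ : ℝ) + 2) ^ 3 * (2 * (ℓ : ℝ) + 5)) := by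
  have hpos : (0 : ℝ) < ℓ := by exact_mod_cast hℓ
  rw [div_pow, dd_one_sq, ff_one_sq]
  field_simp

theorem stmt12 (ℓ : ℕ) (hℓ : 1 ≤ ℓ) :
    ff ℓ 1 / dd ℓ 1 ≤ 1 - 1 / (ℓ : ℝ) + 5 / (2 * (ℓ : ℝ) * ((ℓ : ℝ) + 2)) := by
  have hpos : (0 : ℝ) < ℓ := by exact_mod_cast hℓ
  have hbound : 1 - 1 / (ℓ : ℝ) + 5 / (2 * (ℓ : ℝ) * ((ℓ : ℝ) + 2)) =
      (2 * (ℓ : ℝ) ^ 2 + 2 * ℓ + 1) / (2 * (ℓ : ℝ) * ((ℓ : ℝ) + 2)) := by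
    field_simp
    ring
  rw [hbound]
  refine le_of_sq_le_sq ?_ (by positivity)
  rw [sq_ff_one_div_dd_one hℓ, div_pow, div_le_div_iff₀ (by positivity) (by positivity),
    ← sub_nonneg]
  have hfactor : (2 * (ℓ : ℝ) ^ 2 + 2 * ℓ + 1) ^ 2 *
        ((ℓ : ℝ) * ((ℓ : ℝ) + 2) ^ 3 * (2 * (ℓ : ℝ) + 5)) -
      ((ℓ : ℝ) + 1) ^ 3 * ((ℓ : ℝ) + 3) * (2 * (ℓ : ℝ) + 1) *
        (2 * (ℓ : ℝ) * ((ℓ : ℝ) + 2)) ^ 2 =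
      (ℓ : ℝ) * ((ℓ : ℝ) + 2) ^ 2 *
        (8 * (ℓ : ℝ) ^ 4 + 32 * (ℓ : ℝ) ^ 3 + 54 * (ℓ : ℝ) ^ 2 + 37 * ℓ + 10) := by
    ring
  rw [hfactor]
  positivity
end

section
/- For m = 1 and every positive integer ℓ, f_{2ℓ−1}^1/d_{2ℓ−1}^1 + (1/ℓ)·(f_{2ℓ}^1/d_{2ℓ}^1) + 1/ℓ² ≤ 1 + (1/2)/(ℓ − 1/2) + (7/4)/(ℓ − 1/2)². -/
open Real Finset

/-- The ratio `f_x^1 / d_x^1` as a single square root. -/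
theorem ff_div_dd_one (x : ℕ) (hx : 1 ≤ x) :
    ff x 1 / dd x 1 = √(((x : ℝ) + 3) * ((x : ℝ) + 1) ^ 3 * (2 * x + 1) /
      (x * ((x : ℝ) + 2) ^ 3 * (2 * x + 5))) := by
  have h : (1 : ℝ) ≤ x := by exact_mod_cast hx
  have h0 : (0 : ℝ) < x := by linarith
  have h1 : 0 < 2 * (x : ℝ) + 2 - 1 := by linarith
  unfold ff dd
  push_cast
  simp only [mul_one]
  have hd : 0 ≤ (x : ℝ) + 1 - 1 := by linarith
  rw [← Real.sqrt_sq (show 0 ≤ (x : ℝ) + 1 + 2 by positivity), ← Real.sqrt_sq hd,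
    ← Real.sqrt_mul (sq_nonneg _), ← Real.sqrt_mul (sq_nonneg _),
    ← Real.sqrt_div (by positivity)]
  congr 1
  have e1 : (x : ℝ) + 1 - 1 = x := by ring
  have e2 : 2 * (x : ℝ) + 2 - 1 = 2 * x + 1 := by ring
  rw [e1, e2]
  field_simp
  ring

theorem ff_div_dd_one_le_one (x : ℕ) (hx : 1 ≤ x) : ff x 1 / dd x 1 ≤ 1 := by
  have h : (1 : ℝ) ≤ x := by exact_mod_cast hx
  rw [ff_div_dd_one x hx, Real.sqrt_le_iff, one_pow, and_iff_right zero_le_one,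
    div_le_one (by positivity)]
  obtain ⟨t, ht, e⟩ : ∃ t : ℝ, 0 ≤ t ∧ (x : ℝ) = 1 + t := ⟨x - 1, by linarith, by ring⟩
  rw [e, ← sub_nonneg]
  ring_nf
  positivity

theorem ff_div_dd_one_le (x : ℕ) (hx : 1 ≤ x) :
    ff x 1 / dd x 1 ≤ 1 - 1 / x + 2 / (x : ℝ) ^ 2 := by
  have h : (1 : ℝ) ≤ x := by exact_mod_cast hx
  obtain ⟨t, ht, e⟩ : ∃ t : ℝ, 0 ≤ t ∧ (x : ℝ) = 1 + t := ⟨x - 1, by linarith, by ring⟩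
  have hq : 1 - 1 / (x : ℝ) + 2 / (x : ℝ) ^ 2 = ((x : ℝ) ^ 2 - x + 2) / (x : ℝ) ^ 2 := by
    field_simp
  have hp : 0 ≤ (x : ℝ) ^ 2 - x + 2 := by nlinarith
  rw [ff_div_dd_one x hx, hq]
  refine Real.sqrt_le_iff.mpr ⟨by positivity, ?_⟩
  rw [div_pow, div_le_div_iff₀ (by positivity) (by positivity), e, ← sub_nonneg]
  ring_nf
  positivity

theorem stmt13 (ℓ : ℕ) (hℓ : 1 ≤ ℓ) :
    ff (2 * ℓ - 1) 1 / dd (2 * ℓ - 1) 1 + (1 / (ℓ : ℝ)) * (ff (2 * ℓ) 1 / dd (2 * ℓ) 1) +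
        1 / (ℓ : ℝ) ^ 2 ≤
      1 + (1 / 2) / ((ℓ : ℝ) - 1 / 2) + (7 / 4) / ((ℓ : ℝ) - 1 / 2) ^ 2 := by
  have h : (1 : ℝ) ≤ ℓ := by exact_mod_cast hℓ
  have h₁ := ff_div_dd_one_le (2 * ℓ - 1) (by omega)
  have h₂ := ff_div_dd_one_le_one (2 * ℓ) (by omega)
  have hs : 0 < (ℓ : ℝ) - 1 / 2 := by linarith
  have hc : ((2 * ℓ - 1 : ℕ) : ℝ) = 2 * ((ℓ : ℝ) - 1 / 2) := by
    rw [Nat.cast_sub (by omega)]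
    push_cast
    ring
  rw [hc] at h₁
  have h₃ : 1 / (ℓ : ℝ) * (ff (2 * ℓ) 1 / dd (2 * ℓ) 1) ≤ 1 / ((ℓ : ℝ) - 1 / 2) :=
    (mul_le_of_le_one_right (by positivity) h₂).trans
      (one_div_le_one_div_of_le hs (by linarith))
  have h₄ : 1 / (ℓ : ℝ) ^ 2 ≤ 1 / ((ℓ : ℝ) - 1 / 2) ^ 2 :=
    one_div_le_one_div_of_le (by positivity) (by gcongr; linarith)
  generalize (ℓ : ℝ) - 1 / 2 = s at *
  have h₅ : 0 ≤ 1 / 4 / s ^ 2 := by positivity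
  have e : 1 - 1 / (2 * s) + 2 / (2 * s) ^ 2 + 1 / s + 1 / s ^ 2 + 1 / 4 / s ^ 2 =
      1 + 1 / 2 / s + 7 / 4 / s ^ 2 := by
    field_simp
    ring
  linarith
end

section
/- For m = 1 and every positive integer ℓ, f_{2ℓ}^1/d_{2ℓ}^1 + 1/ℓ ≤ 1 + (1/2)/(ℓ − 1/2) + (5/8)/(ℓ − 1/2)². -/
open Real Finset

/-- The polynomial inequality behind the bound on the squared ratio `ff / dd`, at `x = t + 1`. -/
theorem ratio_poly_le (t : ℝ) (ht : 0 ≤ t) :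
    (2 * t + 5) * (2 * t + 3) ^ 3 * (4 * t + 5) * (2 * (t + 1) * (2 * t + 1) ^ 2) ^ 2 ≤
      (8 * (t + 1) ^ 3 - 12 * (t + 1) ^ 2 + 13 * (t + 1) - 2) ^ 2 *
        ((2 * t + 2) * (2 * t + 4) ^ 3 * (4 * t + 9)) := by
  rw [← sub_nonneg]
  ring_nf
  positivity

theorem stmt14 (ℓ : ℕ) (hℓ : 1 ≤ ℓ) :
    ff (2 * ℓ) 1 / dd (2 * ℓ) 1 + 1 / (ℓ : ℝ) ≤
      1 + (1 / 2) / ((ℓ : ℝ) - 1 / 2) + (5 / 8) / ((ℓ : ℝ) - 1 / 2) ^ 2 := by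
  obtain ⟨n, rfl⟩ := Nat.exists_eq_add_of_le' hℓ
  have ht : (0 : ℝ) ≤ n := n.cast_nonneg
  unfold ff dd
  push_cast
  generalize (n : ℝ) = t at ht
  have hN : 0 < 8 * (t + 1) ^ 3 - 12 * (t + 1) ^ 2 + 13 * (t + 1) - 2 := by
    ring_nf
    positivity
  have hB : 1 + 1 / 2 / (t + 1 - 1 / 2) + 5 / 8 / (t + 1 - 1 / 2) ^ 2 - 1 / (t + 1) =
      (8 * (t + 1) ^ 3 - 12 * (t + 1) ^ 2 + 13 * (t + 1) - 2) /
        (2 * (t + 1) * (2 * t + 1) ^ 2) := by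
    rw [show t + 1 - 1 / 2 = (2 * t + 1) / 2 by ring]
    field_simp
    ring
  rw [← le_sub_iff_add_le, hB]
  have h₁ : 2 * (2 * (t + 1)) + 2 * 1 - 1 = 4 * t + 5 := by ring
  have h₂ : 2 * (t + 1) + 1 - 1 = 2 * t + 2 := by ring
  rw [h₁, h₂]
  refine le_of_pow_le_pow_left₀ two_ne_zero (by positivity) ?_
  rw [div_pow, mul_pow, mul_pow, Real.sq_sqrt (by positivity), Real.sq_sqrt (by positivity)]
  calc
    _ = (2 * t + 5) * (2 * t + 3) ^ 3 * (4 * t + 5) /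
        ((2 * t + 2) * (2 * t + 4) ^ 3 * (4 * t + 9)) := by
      field_simp
      ring
    _ ≤ _ := by
      rw [div_pow, div_le_div_iff₀ (by positivity) (by positivity)]
      exact ratio_poly_le t ht
end

section
/- For m = 1 and every positive integer n, the 2n×2n matrix R is invertible and the squared Frobenius norm of its inverse satisfies ‖R⁻¹‖_F² ≤ 16·e^{2 + 7π²/4}·(2 + log(2n − 1))². -/
open Real Finset

/-- A positive null vector of the (infinite) banded matrix `R` for `m = 1`. -/
noncomputable def nullVec (ℓ : ℕ) : ℝ :=
  Real.sqrt ((2 * (ℓ : ℝ) + 1) / ((ℓ : ℝ) * ((ℓ : ℝ) + 1)))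

/-- The common irrational factor of `d_ℓ`, `e_ℓ`, `f_ℓ` multiplied by `nullVec`. -/
noncomputable def nullFactor (ℓ : ℕ) : ℝ :=
  Real.sqrt ((ℓ : ℝ) * ((ℓ : ℝ) + 3) / (2 * (ℓ : ℝ) + 3))

lemma nullVec_pos {ℓ : ℕ} (h : 0 < ℓ) : 0 < nullVec ℓ := by
  have : (0 : ℝ) < ℓ := by exact_mod_cast h
  unfold nullVec
  positivity

lemma dd_one_pos {ℓ : ℕ} (h : 0 < ℓ) : 0 < dd ℓ 1 := by
  have : (0 : ℝ) < ℓ := by exact_mod_cast h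
  have h1 : (ℓ : ℝ) + (1 : ℕ) - 1 = ℓ := by push_cast; ring
  have h2 : 2 * (ℓ : ℝ) + 2 * (1 : ℕ) - 1 = 2 * ℓ + 1 := by push_cast; ring
  unfold dd
  rw [h1, h2]
  positivity

lemma sqrt_mul_sqrt_eq_mul_sqrt {a b P Q A : ℝ} (ha : 0 ≤ a) (hb : 0 ≤ b)
    (hP : 0 ≤ P) (hQ : 0 ≤ Q) (hA : 0 ≤ A) (h : a ^ 2 * P * Q = b ^ 2 * A) :
    a * Real.sqrt P * Real.sqrt Q = b * Real.sqrt A := by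
  rw [← sq_eq_sq₀ (by positivity) (by positivity)]
  simp only [mul_pow, Real.sq_sqrt hP, Real.sq_sqrt hQ, Real.sq_sqrt hA, h]

lemma dd_mul_nullVec {ℓ : ℕ} (h : 0 < ℓ) :
    dd ℓ 1 * nullVec ℓ = ((ℓ : ℝ) + 2) / (ℓ + 1) * nullFactor ℓ := by
  have : (0 : ℝ) < ℓ := by exact_mod_cast h
  have h1 : (ℓ : ℝ) + (1 : ℕ) - 1 = ℓ := by push_cast; ring
  have h2 : 2 * (ℓ : ℝ) + 2 * (1 : ℕ) - 1 = 2 * ℓ + 1 := by push_cast; ring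
  unfold dd nullVec nullFactor
  rw [h1, h2]
  apply sqrt_mul_sqrt_eq_mul_sqrt <;> try positivity
  push_cast
  field_simp
  ring

lemma ee_mul_nullVec {ℓ : ℕ} (h : 0 < ℓ) :
    ee ℓ 1 * nullVec (ℓ + 1) =
      (2 * (ℓ : ℝ) + 3) / ((ℓ + 1) * (ℓ + 2)) * nullFactor ℓ := by
  have : (0 : ℝ) < ℓ := by exact_mod_cast h
  unfold ee nullVec nullFactor
  rw [← one_mul (Real.sqrt _)]
  apply sqrt_mul_sqrt_eq_mul_sqrt <;> try positivity
  push_cast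
  field_simp
  ring

lemma ff_mul_nullVec {ℓ : ℕ} (h : 0 < ℓ) :
    ff ℓ 1 * nullVec (ℓ + 2) = ((ℓ : ℝ) + 1) / (ℓ + 2) * nullFactor ℓ := by
  have : (0 : ℝ) < ℓ := by exact_mod_cast h
  unfold ff nullVec nullFactor
  apply sqrt_mul_sqrt_eq_mul_sqrt <;> try positivity
  push_cast
  field_simp
  ring

lemma dd_mul_nullVec_eq_add {ℓ : ℕ} (h : 0 < ℓ) :
    dd ℓ 1 * nullVec ℓ = ee ℓ 1 * nullVec (ℓ + 1) + ff ℓ 1 * nullVec (ℓ + 2) := by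
  rw [dd_mul_nullVec h, ee_mul_nullVec h, ff_mul_nullVec h, ← add_mul]
  congr 1
  field_simp
  ring

lemma nullVec_sq_le {ℓ : ℕ} (h : 0 < ℓ) : nullVec ℓ ^ 2 ≤ 2 / ℓ := by
  have : (0 : ℝ) < ℓ := by exact_mod_cast h
  unfold nullVec
  rw [Real.sq_sqrt (by positivity), div_le_div_iff₀ (by positivity) (by positivity)]
  nlinarith

lemma half_le_dd_mul_nullVec_sq {ℓ : ℕ} (h : 0 < ℓ) :
    (ℓ : ℝ) / 2 ≤ (dd ℓ 1 * nullVec ℓ) ^ 2 := by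
  have hl : (0 : ℝ) < ℓ := by exact_mod_cast h
  have h1 : (1 : ℝ) ≤ ((ℓ : ℝ) + 2) / (ℓ + 1) := by
    rw [one_le_div (by positivity)]
    linarith
  rw [dd_mul_nullVec h, mul_pow]
  unfold nullFactor
  rw [Real.sq_sqrt (by positivity)]
  refine le_trans ?_ (le_mul_of_one_le_left (by positivity) (one_le_pow₀ h1))
  rw [div_le_div_iff₀ (by positivity) (by positivity)]
  nlinarith

lemma Rmat_isUnit (N : ℕ) : IsUnit (Rmat N 1) := by
  have htri : (Rmat N 1).IsUpperTriangular := by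
    intro i j hij
    have hij' : (j : ℕ) < i := hij
    simp only [Rmat, Matrix.of_apply]
    rw [if_neg (by omega), if_neg (by omega), if_neg (by omega)]
  rw [Matrix.isUnit_iff_isUnit_det, Matrix.det_of_isUpperTriangular htri, isUnit_iff_ne_zero,
    Finset.prod_ne_zero_iff]
  intro i _
  simpa [Rmat] using (dd_one_pos (Nat.succ_pos (i : ℕ))).ne'

/-- The entries of `R * S`, with the columns of `S` extended by zero. -/
lemma Rmat_mul_apply {N m : ℕ} (S : Matrix (Fin N) (Fin N) ℝ) (j : Fin N) (T : ℕ → ℝ)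
    (hT : ∀ k : Fin N, T k = S k j) (hT0 : ∀ k, N ≤ k → T k = 0) (i : Fin N) :
    (Rmat N m * S) i j =
      dd (i + 1) m * T i - ee (i + 1) m * T (i + 1) - ff (i + 1) m * T (i + 2) := by
  let r : ℕ → ℝ := fun k =>
    (if k = (i : ℕ) then dd (i + 1) m * T k else 0) +
      (if k = (i : ℕ) + 1 then -ee (i + 1) m * T k else 0) +
      (if k = (i : ℕ) + 2 then -ff (i + 1) m * T k else 0)
  have h1 : (Rmat N m * S) i j = ∑ k ∈ range N, r k := by
    rw [Finset.sum_range, Matrix.mul_apply]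
    refine Finset.sum_congr rfl fun k _ => ?_
    simp only [Rmat, Matrix.of_apply, r, hT]
    split_ifs <;> first | omega | ring
  have h2 : ∑ k ∈ range N, r k = ∑ k ∈ range (N + 2), r k := by
    refine Finset.sum_subset (Finset.range_mono (by omega)) fun k _ hk => ?_
    simp [r, hT0 k (by simpa using hk)]
  rw [h1, h2]
  simp only [r, Finset.sum_add_distrib, Finset.sum_ite_eq', Finset.mem_range]
  rw [if_pos (by omega), if_pos (by omega), if_pos (by omega)]
  ring

lemma abs_Rmat_inv_mul_le {N : ℕ} (i j : Fin N) :
    |(Rmat N 1)⁻¹ i j| * (dd (j + 1) 1 * nullVec (j + 1)) ≤ nullVec (i + 1) := by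
  set S := (Rmat N 1)⁻¹ with hS
  let T : ℕ → ℝ := fun k => if h : k < N then S ⟨k, h⟩ j else 0
  have hT : ∀ k : Fin N, T k = S k j := fun k => by simp [T]
  have hT0 : ∀ k, N ≤ k → T k = 0 := fun k hk => by simp [T, hk]
  have hRS : Rmat N 1 * S = 1 :=
    Matrix.mul_nonsing_inv _ ((Matrix.isUnit_iff_isUnit_det _).1 (Rmat_isUnit N))
  have hrec : ∀ k, k < N → dd (k + 1) 1 * T k =
      (if k = (j : ℕ) then 1 else 0) + ee (k + 1) 1 * T (k + 1) + ff (k + 1) 1 * T (k + 2) := by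
    intro k hk
    have h := Rmat_mul_apply (m := 1) S j T hT hT0 ⟨k, hk⟩
    rw [hRS, Matrix.one_apply] at h
    simp only [Fin.ext_iff] at h
    linarith
  have hd : ∀ k : ℕ, 0 < dd (k + 1) 1 := fun k => dd_one_pos k.succ_pos
  have hy : ∀ k : ℕ, 0 < nullVec (k + 1) := fun k => nullVec_pos k.succ_pos
  have hzero : ∀ t k : ℕ, N ≤ k + t → (j : ℕ) < k → T k = 0 := by
    intro t
    induction t with
    | zero => exact fun k hk _ => hT0 k hk
    | succ t ih =>
      intro k hk hjk
      by_cases hkN : N ≤ k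
      · exact hT0 k hkN
      have h := hrec k (by omega)
      rw [if_neg (by omega), ih (k + 1) (by omega) (by omega), ih (k + 2) (by omega) (by omega)] at h
      have := (hd k).ne'
      simpa [this] using h
  set c := dd (j + 1) 1 * nullVec (j + 1) with hc
  have hc0 : 0 < c := mul_pos (hd j) (hy j)
  have hbound : ∀ t k : ℕ, N ≤ k + t → |T k| * c ≤ nullVec (k + 1) := by
    intro t
    induction t with
    | zero => exact fun k hk => by simpa [hT0 k hk] using (hy k).le
    | succ t ih =>
      intro k hk
      by_cases hkN : N ≤ k
      · simpa [hT0 k hkN] using (hy k).le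
      have h := hrec k (by omega)
      by_cases hkj : k = (j : ℕ)
      · rw [if_pos hkj, hzero N (k + 1) (by omega) (by omega),
          hzero N (k + 2) (by omega) (by omega)] at h
        have hpos : 0 < T k := by
          by_contra hneg
          nlinarith [hd k]
        rw [abs_of_pos hpos, hc, ← hkj]
        nlinarith [hy k]
      · rw [if_neg hkj, zero_add] at h
        have h1 := mul_le_mul_of_nonneg_left (ih (k + 1) (by omega)) (ee_nonneg (k + 1) 1)
        have h2 := mul_le_mul_of_nonneg_left (ih (k + 2) (by omega)) (ff_nonneg (k + 1) 1)
        have h3 := dd_mul_nullVec_eq_add k.succ_pos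
        have h4 : dd (k + 1) 1 * |T k| ≤
            ee (k + 1) 1 * |T (k + 1)| + ff (k + 1) 1 * |T (k + 2)| := by
          have := abs_add_le (ee (k + 1) 1 * T (k + 1)) (ff (k + 1) 1 * T (k + 2))
          rwa [← h, abs_mul, abs_mul, abs_mul, abs_of_pos (hd k), abs_of_nonneg (ee_nonneg _ _),
            abs_of_nonneg (ff_nonneg _ _)] at this
        have h5 := mul_le_mul_of_nonneg_right h4 hc0.le
        refine le_of_mul_le_mul_left ?_ (hd k)
        calc dd (k + 1) 1 * (|T k| * c)
            ≤ ee (k + 1) 1 * (|T (k + 1)| * c) + ff (k + 1) 1 * (|T (k + 2)| * c) := by linarith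
          _ ≤ ee (k + 1) 1 * nullVec (k + 1 + 1) + ff (k + 1) 1 * nullVec (k + 1 + 2) :=
              add_le_add h1 h2
          _ = dd (k + 1) 1 * nullVec (k + 1) := h3.symm
  simpa [hT] using hbound N i (by omega)

lemma Rmat_inv_sq_le {N : ℕ} (i j : Fin N) :
    (Rmat N 1)⁻¹ i j ^ 2 ≤ 4 * (((i : ℕ) + 1 : ℝ)⁻¹ * ((j : ℕ) + 1 : ℝ)⁻¹) := by
  have h := pow_le_pow_left₀ (mul_nonneg (abs_nonneg _)
    (mul_pos (dd_one_pos (Nat.succ_pos j)) (nullVec_pos (Nat.succ_pos j))).le)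
    (abs_Rmat_inv_mul_le i j) 2
  rw [mul_pow, sq_abs] at h
  have h1 := nullVec_sq_le (Nat.succ_pos i)
  have h2 := half_le_dd_mul_nullVec_sq (Nat.succ_pos j)
  push_cast at h1 h2
  have h3 := (mul_le_mul_of_nonneg_left h2 (sq_nonneg ((Rmat N 1)⁻¹ i j))).trans (h.trans h1)
  have hi : (0 : ℝ) < (i : ℕ) + 1 := by positivity
  have hj : (0 : ℝ) < (j : ℕ) + 1 := by positivity
  rw [← mul_inv, ← div_eq_mul_inv, le_div_iff₀ (by positivity)]
  rw [le_div_iff₀ hi] at h3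
  linarith

lemma sum_Rmat_inv_sq_le (N : ℕ) :
    ∑ i : Fin N, ∑ j : Fin N, (Rmat N 1)⁻¹ i j ^ 2 ≤ 4 * (1 + Real.log N) ^ 2 := by
  have hH : ∑ i : Fin N, ((i : ℕ) + 1 : ℝ)⁻¹ ≤ 1 + Real.log N := by
    refine le_trans (le_of_eq ?_) (harmonic_le_one_add_log N)
    rw [← Finset.sum_range fun k : ℕ => ((k : ℝ) + 1)⁻¹, harmonic]
    push_cast
    rfl
  calc ∑ i : Fin N, ∑ j : Fin N, (Rmat N 1)⁻¹ i j ^ 2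
      ≤ ∑ i : Fin N, ∑ j : Fin N, 4 * (((i : ℕ) + 1 : ℝ)⁻¹ * ((j : ℕ) + 1 : ℝ)⁻¹) :=
        Finset.sum_le_sum fun i _ => Finset.sum_le_sum fun j _ => Rmat_inv_sq_le i j
    _ = 4 * (∑ i : Fin N, ((i : ℕ) + 1 : ℝ)⁻¹) ^ 2 := by
        rw [sq, Finset.sum_mul_sum, Finset.mul_sum]
        exact Finset.sum_congr rfl fun i _ => (Finset.mul_sum _ _ _).symm
    _ ≤ 4 * (1 + Real.log N) ^ 2 := by
        have : 0 ≤ ∑ i : Fin N, ((i : ℕ) + 1 : ℝ)⁻¹ :=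
          Finset.sum_nonneg fun i _ => by positivity
        gcongr

theorem stmt17 (n : ℕ) (hn : 1 ≤ n) :
    IsUnit (Rmat (2 * n) 1) ∧
      ∑ i : Fin (2 * n), ∑ j : Fin (2 * n), ((Rmat (2 * n) 1)⁻¹ i j) ^ 2 ≤
        16 * Real.exp (2 + 7 * Real.pi ^ 2 / 4) * (2 + Real.log (2 * (n : ℝ) - 1)) ^ 2 := by
  refine ⟨Rmat_isUnit _, (sum_Rmat_inv_sq_le _).trans ?_⟩
  have hn' : (1 : ℝ) ≤ n := by exact_mod_cast hn
  have hlog : Real.log ((2 * n : ℕ) : ℝ) ≤ 1 + Real.log (2 * (n : ℝ) - 1) := by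
    rw [Real.log_le_iff_le_exp (by positivity), Real.exp_add, Real.exp_log (by linarith)]
    push_cast
    nlinarith [Real.add_one_le_exp (1 : ℝ)]
  have hlog0 : 0 ≤ Real.log ((2 * n : ℕ) : ℝ) := Real.log_natCast_nonneg _
  have hexp : 1 ≤ Real.exp (2 + 7 * Real.pi ^ 2 / 4) := Real.one_le_exp (by positivity)
  have h4 : (4 : ℝ) ≤ 16 * Real.exp (2 + 7 * Real.pi ^ 2 / 4) := by linarith
  exact mul_le_mul h4 (pow_le_pow_left₀ (by linarith) (by linarith) 2) (by positivity)
    (by positivity)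
end
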